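/- arXiv:1805.01507 — 2 statements merged into one kernel-verified Lean document; each statement's English description precedes it below -/
import Mathlib

section
/- Let (M,d) be a metric space, (μ_ε)_{ε>0} a family of Borel probability measures on M, and S : M → [0,∞] a lower semicontinuous function satisfying the LDP upper bound: for every closed set F ⊆ M, limsup_{ε→0} ε · log μ_ε(F) ≤ −inf_{x∈F} S(x). For η > 0 define S^η(x) := inf_{y : d(y,x) ≤ η} S(y). Then for every continuous φ : M → [0,C], every Borel measurable ψ : M → [−∞, C], and every η > 0, limsup_{ε→0} ε · log ∫_M φ(x) · exp(ψ(x)/ε) dμ_ε(x) ≤ sup_{x ∈ supp(φ)} (ψ(x) − S^η(x)). -/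
open MeasureTheory Filter Topology
open scoped ENNReal NNReal

theorem aux_log_le (ε : ℝ) (hε : 0 < ε) (b : ℝ) (m : ℝ≥0∞) :
    (ε : EReal) * ENNReal.log m ≤ (b : EReal) ↔ m ≤ ENNReal.ofReal (Real.exp (b / ε)) := by
  have h1 : m ≤ ENNReal.ofReal (Real.exp (b / ε)) ↔ ENNReal.log m ≤ ((b / ε : ℝ) : EReal) := by
    rw [← EReal.exp_coe]
    constructor
    · intro h
      have := ENNReal.log_monotone h
      rwa [EReal.log_exp] at this
    · intro h
      have := EReal.exp_monotone h
      rwa [ENNReal.exp_log] at this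
  rw [h1]
  induction ENNReal.log m with
  | bot => simp [EReal.coe_mul_bot_of_pos hε]
  | top => simp [EReal.coe_mul_top_of_pos hε]
  | coe x =>
    rw [← EReal.coe_mul, EReal.coe_le_coe_iff, EReal.coe_le_coe_iff, le_div_iff₀ hε, mul_comm]

theorem aux_exp_le (ε : ℝ) (hε : 0 < ε) (b : ℝ) (p : EReal) (h : p ≤ b) :
    EReal.exp (((ε⁻¹ : ℝ) : EReal) * p) ≤ ENNReal.ofReal (Real.exp (b / ε)) := by
  rw [← EReal.exp_coe]
  apply EReal.exp_monotone
  have h0 : (0 : EReal) ≤ ((ε⁻¹ : ℝ) : EReal) := by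
    exact_mod_cast (inv_pos.2 hε).le
  calc ((ε⁻¹ : ℝ) : EReal) * p ≤ ((ε⁻¹ : ℝ) : EReal) * b := mul_le_mul_of_nonneg_left h h0
    _ = ((b / ε : ℝ) : EReal) := by
      rw [← EReal.coe_mul, div_eq_inv_mul]

/-- Formula (actf2) of the paper: an upper Laplace-type bound valid for merely
measurable exponents `ψ : M → [−∞, C]`, where the rate function `S` is replaced by
its `η`-mollification `S^η(x) = inf_{d(y,x) ≤ η} S(y)`:
`limsup_{ε→0} ε log ∫ φ e^{ψ/ε} dμ_ε ≤ sup_{x ∈ supp φ} (ψ(x) − S^η(x))`. -/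
theorem laplace_upper_bound_measurable
    {M : Type*} [MetricSpace M] [MeasurableSpace M] [BorelSpace M]
    (μ : ℝ → Measure M) (hprob : ∀ ε : ℝ, 0 < ε → IsProbabilityMeasure (μ ε))
    (S : M → ℝ≥0∞) (hS : LowerSemicontinuous S)
    (hLDPupper : ∀ F : Set M, IsClosed F →
      Filter.limsup (fun ε : ℝ => (ε : EReal) * ENNReal.log (μ ε F)) (𝓝[>] (0 : ℝ))
        ≤ - ⨅ x ∈ F, (S x : EReal))
    (η : ℝ) (hη : 0 < η)
    (Sη : M → ℝ≥0∞) (hSη : ∀ x, Sη x = ⨅ y ∈ Metric.closedBall x η, S y)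
    (C : ℝ) (hC : 0 < C)
    (φ : M → ℝ) (hφcont : Continuous φ) (hφrange : ∀ x, φ x ∈ Set.Icc (0 : ℝ) C)
    (ψ : M → EReal) (hψmeas : Measurable ψ) (hψle : ∀ x, ψ x ≤ (C : EReal)) :
    Filter.limsup
      (fun ε : ℝ => (ε : EReal) *
        ENNReal.log (∫⁻ x, ENNReal.ofReal (φ x) * EReal.exp (((ε⁻¹ : ℝ) : EReal) * ψ x) ∂(μ ε)))
      (𝓝[>] (0 : ℝ))
      ≤ ⨆ x ∈ tsupport φ, (ψ x - (Sη x : EReal)) := by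
  rw [← EReal.le_of_forall_lt_iff_le]
  intro z hz
  obtain ⟨K, hRK, hKz⟩ := EReal.lt_iff_exists_real_btwn.1 hz
  have hKz' : K < z := by exact_mod_cast hKz
  obtain ⟨δ, hδ⟩ : ∃ δ : ℝ, δ = (z - K) / 3 := ⟨_, rfl⟩
  have hδ0 : 0 < δ := by rw [hδ]; linarith
  have hz3 : z = K + 3 * δ := by rw [hδ]; ring
  let a : ℕ → ℝ := fun k => K + k * δ
  let A : ℕ → Set M := fun k => {x | x ∈ tsupport φ ∧ ((a k : ℝ) : EReal) < ψ x}
  let n : ℕ := ⌈(C - K) / δ⌉₊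
  -- rate bound on closures
  have hrate : ∀ k, ∀ y ∈ closure (A k), ((a k - K : ℝ) : EReal) ≤ (S y : EReal) := by
    intro k y hy
    obtain ⟨x, hx, hxy⟩ := Metric.mem_closure_iff.1 hy η hη
    have h1 : Sη x ≤ S y := by
      rw [hSη]
      exact iInf₂_le y (Metric.mem_closedBall.2 hxy.le)
    have h2 : ψ x - (Sη x : EReal) ≤ K :=
      (le_iSup₂ (f := fun x (_ : x ∈ tsupport φ) => ψ x - (Sη x : EReal)) x hx.1).trans hRK.le
    have h3 : (Sη x : EReal) ≤ (S y : EReal) := by exact_mod_cast h1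
    refine le_trans ?_ h3
    have h4 : ((a k : ℝ) : EReal) - (Sη x : EReal) ≤ K :=
      (EReal.sub_le_sub hx.2.le le_rfl).trans h2
    rcases eq_or_ne (Sη x) ⊤ with h | h
    · rw [h]; simp
    · lift Sη x to ℝ≥0 using h with s
      have hs : (((s : ℝ≥0) : ℝ≥0∞) : EReal) = ((s : ℝ) : EReal) := rfl
      rw [hs, ← EReal.coe_sub, EReal.coe_le_coe_iff] at h4
      rw [hs, EReal.coe_le_coe_iff]
      linarith
  have hev : ∀ k, ∀ᶠ ε in 𝓝[>] (0 : ℝ),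
      μ ε (closure (A k)) ≤ ENNReal.ofReal (Real.exp ((K - a k + δ) / ε)) := by
    intro k
    have h1 : Filter.limsup (fun ε : ℝ => (ε : EReal) * ENNReal.log (μ ε (closure (A k))))
        (𝓝[>] (0 : ℝ)) < ((K - a k + δ : ℝ) : EReal) := by
      refine lt_of_le_of_lt (hLDPupper _ isClosed_closure) ?_
      have h2 : ((a k - K : ℝ) : EReal) ≤ ⨅ x ∈ closure (A k), (S x : EReal) :=
        le_iInf₂ (hrate k)
      refine lt_of_le_of_lt (EReal.neg_le_neg_iff.2 h2) ?_
      rw [← EReal.coe_neg, EReal.coe_lt_coe_iff]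
      linarith
    filter_upwards [eventually_lt_of_limsup_lt h1, self_mem_nhdsWithin] with ε hε hε0
    exact (aux_log_le ε hε0 _ _).1 hε.le
  have hev' : ∀ᶠ ε in 𝓝[>] (0 : ℝ), ∀ k ∈ Finset.range n,
      μ ε (closure (A k)) ≤ ENNReal.ofReal (Real.exp ((K - a k + δ) / ε)) :=
    (Filter.eventually_all_finset _).2 fun k _ => hev k
  have hlim : ∀ᶠ ε in 𝓝[>] (0 : ℝ), C * (n + 1) ≤ Real.exp (δ / ε) := by
    have : Tendsto (fun ε : ℝ => Real.exp (δ / ε)) (𝓝[>] 0) atTop := by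
      have h : Tendsto (fun ε : ℝ => δ / ε) (𝓝[>] 0) atTop := by
        simp only [div_eq_mul_inv]
        exact tendsto_inv_nhdsGT_zero.const_mul_atTop hδ0
      exact Real.tendsto_exp_atTop.comp h
    exact this.eventually_ge_atTop _
  refine Filter.limsup_le_of_le (by isBoundedDefault) ?_
  filter_upwards [hev', hlim, self_mem_nhdsWithin] with ε hε hc hε0
  have hε0 : 0 < ε := hε0
  have := hprob ε hε0
  rw [aux_log_le ε hε0]
  let G : M → ℝ≥0∞ := fun x => ENNReal.ofReal C * (ENNReal.ofReal (Real.exp (K / ε)) +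
    ∑ k ∈ Finset.range n, (closure (A k)).indicator
      (fun _ => ENNReal.ofReal (Real.exp ((a k + δ) / ε))) x)
  have hpt : ∀ x, ENNReal.ofReal (φ x) * EReal.exp (((ε⁻¹ : ℝ) : EReal) * ψ x) ≤ G x := by
    intro x
    rcases eq_or_ne (φ x) 0 with h0 | h0
    · simp [h0]
    have hxs : x ∈ tsupport φ := subset_tsupport _ h0
    refine mul_le_mul' (ENNReal.ofReal_le_ofReal (hφrange x).2) ?_
    rcases le_or_gt (ψ x) K with hK | hK
    · exact (aux_exp_le ε hε0 K _ hK).trans le_self_add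
    · have hψC := hψle x
      obtain ⟨p, hp⟩ : ∃ p : ℝ, ψ x = p := by
        refine ⟨(ψ x).toReal, (EReal.coe_toReal ?_ ?_).symm⟩
        · exact ne_top_of_le_ne_top (EReal.coe_ne_top C) hψC
        · exact ne_bot_of_gt hK
      have hKp : K < p := by rw [hp] at hK; exact_mod_cast hK
      have hpC : p ≤ C := by rw [hp] at hψC; exact_mod_cast hψC
      have hq : 0 < (p - K) / δ := div_pos (by linarith) hδ0
      have hm : 0 < ⌈(p - K) / δ⌉₊ := Nat.ceil_pos.2 hq
      obtain ⟨k, hk⟩ := Nat.exists_eq_succ_of_ne_zero hm.ne'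
      have hkn : k < n := by
        have : ⌈(p - K) / δ⌉₊ ≤ n := Nat.ceil_mono (by gcongr)
        omega
      have hlo : a k < p := by
        have : (k : ℝ) < (p - K) / δ := Nat.lt_ceil.1 (by omega)
        rw [lt_div_iff₀ hδ0] at this
        simp only [a]; linarith
      have hhi : p ≤ a k + δ := by
        have : (p - K) / δ ≤ ((k + 1 : ℕ) : ℝ) := Nat.ceil_le.1 (by omega)
        rw [div_le_iff₀ hδ0] at this
        push_cast at this
        simp only [a]; linarith
      have hxA : x ∈ closure (A k) := subset_closure ⟨hxs, by rw [hp]; exact_mod_cast hlo⟩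
      have h1 : EReal.exp (((ε⁻¹ : ℝ) : EReal) * ψ x) ≤ (closure (A k)).indicator
          (fun _ => ENNReal.ofReal (Real.exp ((a k + δ) / ε))) x := by
        rw [Set.indicator_of_mem hxA]
        exact aux_exp_le ε hε0 _ _ (by rw [hp]; exact_mod_cast hhi)
      refine h1.trans (le_trans ?_ le_add_self)
      exact Finset.single_le_sum (f := fun k => (closure (A k)).indicator
          (fun _ => ENNReal.ofReal (Real.exp ((a k + δ) / ε))) x)
        (fun _ _ => zero_le) (Finset.mem_range.2 hkn)
  have hmeas : ∀ k, Measurable ((closure (A k)).indicator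
      (fun _ : M => ENNReal.ofReal (Real.exp ((a k + δ) / ε)))) := fun k =>
    measurable_const.indicator isClosed_closure.measurableSet
  have hG : ∫⁻ x, G x ∂(μ ε) = ENNReal.ofReal C * (ENNReal.ofReal (Real.exp (K / ε)) +
      ∑ k ∈ Finset.range n, ENNReal.ofReal (Real.exp ((a k + δ) / ε)) * μ ε (closure (A k))) := by
    simp only [G]
    rw [lintegral_const_mul' _ _ ENNReal.ofReal_ne_top, lintegral_add_left measurable_const,
      lintegral_finsetSum _ (fun k _ => hmeas k)]
    congr 2
    · simp
    · refine Finset.sum_congr rfl fun k _ => ?_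
      rw [lintegral_indicator_const isClosed_closure.measurableSet]
  refine (lintegral_mono hpt).trans ?_
  rw [hG]
  let E : ℝ≥0∞ := ENNReal.ofReal (Real.exp ((K + 2 * δ) / ε))
  have hb1 : ENNReal.ofReal (Real.exp (K / ε)) ≤ E := by
    apply ENNReal.ofReal_le_ofReal
    gcongr
    linarith
  have hb2 : ∀ k ∈ Finset.range n,
      ENNReal.ofReal (Real.exp ((a k + δ) / ε)) * μ ε (closure (A k)) ≤ E := by
    intro k hk
    refine (mul_le_mul' le_rfl (hε k hk)).trans ?_
    rw [← ENNReal.ofReal_mul (Real.exp_pos _).le, ← Real.exp_add]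
    apply le_of_eq
    simp only [E]
    congr 2
    ring
  calc _ ≤ ENNReal.ofReal C * (E + ∑ k ∈ Finset.range n, E) := by
        gcongr with k hk
        exact hb2 k hk
    _ = ENNReal.ofReal (C * (n + 1) * Real.exp ((K + 2 * δ) / ε)) := by
        rw [ENNReal.ofReal_mul (by positivity), ENNReal.ofReal_mul hC.le,
          ENNReal.ofReal_add (by positivity) zero_le_one, Finset.sum_const, Finset.card_range,
          nsmul_eq_mul, ENNReal.ofReal_natCast, ENNReal.ofReal_one]
        ring
    _ ≤ ENNReal.ofReal (Real.exp (δ / ε) * Real.exp ((K + 2 * δ) / ε)) := by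
        apply ENNReal.ofReal_le_ofReal
        gcongr
    _ = ENNReal.ofReal (Real.exp (z / ε)) := by
        rw [← Real.exp_add, hz3]
        congr 2
        ring
end

section
/- Let n ≥ 1, let a¹, a² be symmetric positive definite n×n real matrices, and let c¹, c² > 0 be real constants. For p ∈ [0,1] set B_p = p·a¹ + (1−p)·a², T_p = p·c¹ + (1−p)·c², and Q_p(x) = ⟨B_p⁻¹ x, x⟩ for x ∈ ℝⁿ. Then the function N : ℝⁿ → [0,∞) defined by N(x) = min_{p∈[0,1]} √( Q_p(x) / (2·T_p) ) is a norm on ℝⁿ: N(x) = 0 if and only if x = 0; N(a·x) = |a|·N(x) for all a ∈ ℝ and x ∈ ℝⁿ; and N(x + y) ≤ N(x) + N(y) for all x, y ∈ ℝⁿ. -/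
open Matrix

/-- The convex combination `B_p = p·a¹ + (1−p)·a²` of the diffusion matrices. -/
noncomputable def Bp {n : ℕ} (a1 a2 : Matrix (Fin n) (Fin n) ℝ) (p : ℝ) :
    Matrix (Fin n) (Fin n) ℝ :=
  p • a1 + (1 - p) • a2

/-- The convex combination `T_p = p·c¹ + (1−p)·c²` of the reaction rates. -/
noncomputable def Tp (c1 c2 p : ℝ) : ℝ := p * c1 + (1 - p) * c2

/-- The quadratic form `Q_p(x) = ⟨B_p⁻¹ x, x⟩`. -/
noncomputable def Qp {n : ℕ} (a1 a2 : Matrix (Fin n) (Fin n) ℝ) (p : ℝ)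
    (x : Fin n → ℝ) : ℝ :=
  (Bp a1 a2 p)⁻¹.mulVec x ⬝ᵥ x

/-- `λ(t,x) = sup_{p ∈ [0,1]} ( t·T_p − Q_p(x)/(2t) )`, formula (gtmo) of the paper. -/
noncomputable def lam {n : ℕ} (a1 a2 : Matrix (Fin n) (Fin n) ℝ) (c1 c2 : ℝ)
    (t : ℝ) (x : Fin n → ℝ) : ℝ :=
  ⨆ p : Set.Icc (0 : ℝ) 1, (t * Tp c1 c2 p - Qp a1 a2 (p : ℝ) x / (2 * t))

/-- `N(x) = min_{p∈[0,1]} √(Q_p(x)/(2T_p))`, the Finsler norm of Section 2.2. -/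
noncomputable def Nnorm {n : ℕ} (a1 a2 : Matrix (Fin n) (Fin n) ℝ) (c1 c2 : ℝ)
    (x : Fin n → ℝ) : ℝ :=
  sInf {r : ℝ | ∃ p ∈ Set.Icc (0 : ℝ) 1,
    r = Real.sqrt (Qp a1 a2 p x / (2 * Tp c1 c2 p))}


lemma Bp_posDef {n : ℕ} {a1 a2 : Matrix (Fin n) (Fin n) ℝ} (ha1 : a1.PosDef) (ha2 : a2.PosDef)
    {p : ℝ} (hp : p ∈ Set.Icc (0:ℝ) 1) : (Bp a1 a2 p).PosDef := by
  unfold Bp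
  rcases eq_or_lt_of_le hp.1 with h | h
  · subst h; simpa using ha2
  · exact (ha1.smul h).add_posSemidef (ha2.posSemidef.smul (by linarith [hp.2]))

lemma Tp_pos {c1 c2 : ℝ} (hc1 : 0 < c1) (hc2 : 0 < c2)
    {p : ℝ} (hp : p ∈ Set.Icc (0:ℝ) 1) : 0 < Tp c1 c2 p := by
  unfold Tp
  rcases eq_or_lt_of_le hp.1 with h | h
  · subst h; simpa using hc2
  · have := mul_pos h hc1
    have := mul_nonneg (by linarith [hp.2] : 0 ≤ 1 - p) hc2.le
    linarith

lemma form_nonneg {n : ℕ} {B : Matrix (Fin n) (Fin n) ℝ} (hB : B.PosDef) (x : Fin n → ℝ) :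
    0 ≤ x ⬝ᵥ B *ᵥ x := by
  simpa using hB.posSemidef.dotProduct_mulVec_nonneg x

lemma form_symm {n : ℕ} {B : Matrix (Fin n) (Fin n) ℝ} (hB : B.PosDef) (x y : Fin n → ℝ) :
    x ⬝ᵥ B *ᵥ y = y ⬝ᵥ B *ᵥ x := by
  have h : Bᵀ = B := by 
    have := hB.isHermitian.eq
    rwa [conjTranspose_eq_transpose_of_trivial] at this
  rw [dotProduct_mulVec, ← mulVec_transpose, h, dotProduct_comm]

lemma key {n : ℕ} {B : Matrix (Fin n) (Fin n) ℝ} (hB : B.PosDef) (x z : Fin n → ℝ) {w : ℝ}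
    (hw : 0 < w) :
    2 * (z ⬝ᵥ x) - w * (z ⬝ᵥ B *ᵥ z) ≤ (B⁻¹ *ᵥ x ⬝ᵥ x) / w := by
  have hu : B *ᵥ (B⁻¹ *ᵥ x) = x := by
    rw [mulVec_mulVec, mul_nonsing_inv _ ((isUnit_iff_isUnit_det _).1 hB.isUnit), one_mulVec]
  have h := form_nonneg hB (w • z - B⁻¹ *ᵥ x)
  have hs := form_symm hB (B⁻¹ *ᵥ x) z
  rw [hu] at hs
  simp only [mulVec_sub, mulVec_smul, hu, dotProduct_sub, sub_dotProduct, smul_dotProduct,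
    dotProduct_smul, smul_eq_mul, hs] at h
  rw [le_div_iff₀ hw]
  nlinarith

lemma Qp_nonneg {n : ℕ} {a1 a2 : Matrix (Fin n) (Fin n) ℝ} (ha1 : a1.PosDef) (ha2 : a2.PosDef)
    {p : ℝ} (hp : p ∈ Set.Icc (0:ℝ) 1) (x : Fin n → ℝ) : 0 ≤ Qp a1 a2 p x := by
  unfold Qp
  rw [dotProduct_comm]
  exact form_nonneg (Bp_posDef ha1 ha2 hp).inv x

lemma Qp_pos {n : ℕ} {a1 a2 : Matrix (Fin n) (Fin n) ℝ} (ha1 : a1.PosDef) (ha2 : a2.PosDef)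
    {p : ℝ} (hp : p ∈ Set.Icc (0:ℝ) 1) {x : Fin n → ℝ} (hx : x ≠ 0) : 0 < Qp a1 a2 p x := by
  unfold Qp
  rw [dotProduct_comm]
  simpa using (Bp_posDef ha1 ha2 hp).inv.dotProduct_mulVec_pos hx

lemma Qp_add {n : ℕ} {a1 a2 : Matrix (Fin n) (Fin n) ℝ} (ha1 : a1.PosDef) (ha2 : a2.PosDef)
    {p q : ℝ} (hp : p ∈ Set.Icc (0:ℝ) 1) (hq : q ∈ Set.Icc (0:ℝ) 1) (x y : Fin n → ℝ)
    {w v : ℝ} (hw : 0 < w) (hv : 0 < v) (hwv : w + v = 1) :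
    Qp a1 a2 (w * p + v * q) (x + y) ≤ Qp a1 a2 p x / w + Qp a1 a2 q y / v := by
  have hr : w * p + v * q ∈ Set.Icc (0:ℝ) 1 := by
    have := (convex_Icc (0:ℝ) 1) hp hq hw.le hv.le hwv
    simpa using this
  have hB := Bp_posDef ha1 ha2 hr
  have hsum : Bp a1 a2 (w * p + v * q) = w • Bp a1 a2 p + v • Bp a1 a2 q := by
    have : v = 1 - w := by linarith
    subst this
    unfold Bp
    module
  have h1 := key (Bp_posDef ha1 ha2 hp) x ((Bp a1 a2 (w * p + v * q))⁻¹ *ᵥ (x + y)) hw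
  have h2 := key (Bp_posDef ha1 ha2 hq) y ((Bp a1 a2 (w * p + v * q))⁻¹ *ᵥ (x + y)) hv
  have hu : Bp a1 a2 (w * p + v * q) *ᵥ ((Bp a1 a2 (w * p + v * q))⁻¹ *ᵥ (x + y)) = x + y := by
    rw [mulVec_mulVec, mul_nonsing_inv _ ((isUnit_iff_isUnit_det _).1 hB.isUnit), one_mulVec]
  unfold Qp
  generalize (Bp a1 a2 (w * p + v * q))⁻¹ *ᵥ (x + y) = z at *
  rw [hsum] at hu
  have h3 := congrArg (fun t => z ⬝ᵥ t) hu
  simp only [add_mulVec, smul_mulVec, dotProduct_add, dotProduct_smul, smul_eq_mul] at h3 ⊢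
  linarith

lemma f_cont {n : ℕ} {a1 a2 : Matrix (Fin n) (Fin n) ℝ} (ha1 : a1.PosDef) (ha2 : a2.PosDef)
    {c1 c2 : ℝ} (hc1 : 0 < c1) (hc2 : 0 < c2) (x : Fin n → ℝ) :
    ContinuousOn (fun p => Real.sqrt (Qp a1 a2 p x / (2 * Tp c1 c2 p))) (Set.Icc 0 1) := by
  have hB : Continuous (fun p => Bp a1 a2 p) := by unfold Bp; fun_prop
  have hT : Continuous (fun p => Tp c1 c2 p) := by unfold Tp; fun_prop
  have hi : ContinuousOn (fun p => (Bp a1 a2 p)⁻¹) (Set.Icc 0 1) := by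
    simp only [inv_def, Ring.inverse_eq_inv']
    exact (hB.matrix_det.continuousOn.inv₀
      (fun p hp => (Bp_posDef ha1 ha2 hp).det_pos.ne')).smul hB.matrix_adjugate.continuousOn
  have hQ : ContinuousOn (fun p => Qp a1 a2 p x) (Set.Icc 0 1) := by
    have : Continuous (fun M : Matrix (Fin n) (Fin n) ℝ => M *ᵥ x ⬝ᵥ x) := by fun_prop
    exact this.comp_continuousOn hi
  refine (hQ.div (by fun_prop) fun p hp => ?_).sqrt
  have := Tp_pos hc1 hc2 hp
  positivity

theorem Nnorm_is_norm
    (n : ℕ) (hn : 1 ≤ n) (a1 a2 : Matrix (Fin n) (Fin n) ℝ)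
    (ha1 : a1.PosDef) (ha2 : a2.PosDef)
    (c1 c2 : ℝ) (hc1 : 0 < c1) (hc2 : 0 < c2) :
    (∀ x : Fin n → ℝ, IsLeast {r : ℝ | ∃ p ∈ Set.Icc (0 : ℝ) 1,
        r = Real.sqrt (Qp a1 a2 p x / (2 * Tp c1 c2 p))} (Nnorm a1 a2 c1 c2 x)) ∧
    (∀ x : Fin n → ℝ, 0 ≤ Nnorm a1 a2 c1 c2 x) ∧
    (∀ x : Fin n → ℝ, Nnorm a1 a2 c1 c2 x = 0 ↔ x = 0) ∧
    (∀ (a : ℝ) (x : Fin n → ℝ),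
      Nnorm a1 a2 c1 c2 (a • x) = |a| * Nnorm a1 a2 c1 c2 x) ∧
    (∀ x y : Fin n → ℝ,
      Nnorm a1 a2 c1 c2 (x + y) ≤ Nnorm a1 a2 c1 c2 x + Nnorm a1 a2 c1 c2 y) := by
  have hL : ∀ x : Fin n → ℝ, IsLeast {r : ℝ | ∃ p ∈ Set.Icc (0 : ℝ) 1,
        r = Real.sqrt (Qp a1 a2 p x / (2 * Tp c1 c2 p))} (Nnorm a1 a2 c1 c2 x) := by
    intro x
    have hS : {r : ℝ | ∃ p ∈ Set.Icc (0 : ℝ) 1,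
        r = Real.sqrt (Qp a1 a2 p x / (2 * Tp c1 c2 p))} =
        (fun p => Real.sqrt (Qp a1 a2 p x / (2 * Tp c1 c2 p))) '' Set.Icc 0 1 := by
      ext r; simp only [Set.mem_ofPred_eq, Set.mem_image, eq_comm]
    unfold Nnorm
    rw [hS]
    have hc := isCompact_Icc.image_of_continuousOn (f_cont ha1 ha2 hc1 hc2 x)
    exact hc.isLeast_sInf ((Set.nonempty_Icc.2 zero_le_one).image _)
  have h0 : ∀ x : Fin n → ℝ, 0 ≤ Nnorm a1 a2 c1 c2 x := by
    intro x
    obtain ⟨p, hp, h⟩ := (hL x).1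
    rw [h]; exact Real.sqrt_nonneg _
  have hz : ∀ x : Fin n → ℝ, Nnorm a1 a2 c1 c2 x = 0 ↔ x = 0 := by
    intro x
    obtain ⟨p, hp, h⟩ := (hL x).1
    constructor
    · intro hN
      by_contra hx
      have := Qp_pos ha1 ha2 hp hx
      have := Tp_pos hc1 hc2 hp
      have : 0 < Real.sqrt (Qp a1 a2 p x / (2 * Tp c1 c2 p)) := by positivity
      linarith
    · rintro rfl
      rw [h]; simp [Qp]
  refine ⟨hL, h0, hz, ?_, ?_⟩
  · intro a x
    have hf : ∀ p, Real.sqrt (Qp a1 a2 p (a • x) / (2 * Tp c1 c2 p)) =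
        |a| * Real.sqrt (Qp a1 a2 p x / (2 * Tp c1 c2 p)) := by
      intro p
      rw [← Real.sqrt_sq_eq_abs, ← Real.sqrt_mul (sq_nonneg a)]
      congr 1
      simp only [Qp, mulVec_smul, smul_dotProduct, dotProduct_smul, smul_eq_mul]
      ring
    obtain ⟨p, hp, h⟩ := (hL x).1
    obtain ⟨q, hq, h'⟩ := (hL (a • x)).1
    apply le_antisymm
    · rw [h, ← hf]
      exact (hL (a • x)).2 ⟨p, hp, rfl⟩
    · rw [h', hf]
      exact mul_le_mul_of_nonneg_left ((hL x).2 ⟨q, hq, rfl⟩) (abs_nonneg a)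
  · intro x y
    rcases eq_or_ne x 0 with rfl | hx
    · simpa using h0 0
    rcases eq_or_ne y 0 with rfl | hy
    · simpa using h0 0
    have hs : 0 < Nnorm a1 a2 c1 c2 x := lt_of_le_of_ne (h0 x) fun h => hx ((hz x).1 h.symm)
    have ht : 0 < Nnorm a1 a2 c1 c2 y := lt_of_le_of_ne (h0 y) fun h => hy ((hz y).1 h.symm)
    obtain ⟨p, hp, h⟩ := (hL x).1
    obtain ⟨q, hq, h'⟩ := (hL y).1
    have hL' := (hL (x + y)).2
    generalize Nnorm a1 a2 c1 c2 x = s at *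
    generalize Nnorm a1 a2 c1 c2 y = t at *
    have hTp := Tp_pos hc1 hc2 hp
    have hTq := Tp_pos hc1 hc2 hq
    have hQp : Qp a1 a2 p x = s ^ 2 * (2 * Tp c1 c2 p) := by
      rw [h, Real.sq_sqrt (div_nonneg (Qp_nonneg ha1 ha2 hp x) (by positivity))]
      field_simp
    have hQq : Qp a1 a2 q y = t ^ 2 * (2 * Tp c1 c2 q) := by
      rw [h', Real.sq_sqrt (div_nonneg (Qp_nonneg ha1 ha2 hq y) (by positivity))]
      field_simp
    clear h h'
    have hw : 0 < s / (s + t) := by positivity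
    have hv : 0 < t / (s + t) := by positivity
    have hwv : s / (s + t) + t / (s + t) = 1 := by field_simp
    have hr : s / (s + t) * p + t / (s + t) * q ∈ Set.Icc (0:ℝ) 1 := by
      simpa using (convex_Icc (0:ℝ) 1) hp hq hw.le hv.le hwv
    refine (hL' ⟨_, hr, rfl⟩).trans ?_
    have hTr := Tp_pos hc1 hc2 hr
    rw [Real.sqrt_le_left (by positivity), div_le_iff₀ (by positivity)]
    refine (Qp_add ha1 ha2 hp hq x y hw hv hwv).trans (le_of_eq ?_)
    rw [hQp, hQq]
    unfold Tp
    field_simp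
    ring
end
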